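/- Let (X,+) be an abelian group equipped with a translation-invariant metric d such that X is complete and locally compact and every nonempty open ball in X contains infinitely many elements. Let A ⊆ X be a nonempty compact set. Then the spectre operator S, acting on nonempty compact subsets of X with the Hausdorff distance, is continuous at A if and only if S(A) = {0}. -/

import Mathlib

open Metric

/-- The spectre of a set `A` in an abelian group. -/
def spectre {X : Type*} [AddCommGroup X] (A : Set X) : Set X :=
  {z | ∀ x ∈ A, x + z ∈ A ∨ x - z ∈ A}

open Filter Topology Pointwise

theorem spectre_zero_mem {X : Type*} [AddCommGroup X] (A : Set X) : (0 : X) ∈ spectre A :=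
  fun x hx => Or.inl (by simpa using hx)

theorem dist_add_zero' {X : Type*} [AddCommGroup X] [MetricSpace X]
    (hd : ∀ x y z : X, dist (x + z) (y + z) = dist x y) (x z : X) :
    dist (x + z) x = dist z 0 := by
  have := hd z 0 x
  rwa [zero_add, add_comm] at this

theorem dist_sub_zero' {X : Type*} [AddCommGroup X] [MetricSpace X]
    (hd : ∀ x y z : X, dist (x + z) (y + z) = dist x y) (x z : X) :
    dist (x - z) x = dist z 0 := by
  rw [← dist_add_zero' hd (x - z) z, sub_add_cancel, dist_comm]

theorem topGroup_of_inv {X : Type*} [AddCommGroup X] [MetricSpace X]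
    (hd : ∀ x y z : X, dist (x + z) (y + z) = dist x y) : IsTopologicalAddGroup X := by
  have hadd : ∀ a b c d : X, dist (a + b) (c + d) ≤ dist a c + dist b d := by
    intro a b c d
    calc dist (a + b) (c + d) ≤ dist (a + b) (c + b) + dist (c + b) (c + d) := dist_triangle _ _ _
      _ = dist a c + dist b d := by rw [hd, add_comm c b, add_comm c d, hd]
  have hneg : ∀ a b : X, dist (-a) (-b) = dist a b := by
    intro a b
    have := hd (-a) (-b) (a + b)
    rw [← this, dist_comm a b]
    congr 1 <;> abel
  refine { continuous_add := ?_, continuous_neg := ?_ }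
  · rw [continuous_iff_continuousAt]
    rintro ⟨c, d⟩
    refine tendsto_iff_dist_tendsto_zero.2 ?_
    refine squeeze_zero (fun _ => dist_nonneg) (fun p => hadd p.1 p.2 c d) ?_
    have : Continuous (fun p : X × X => dist p.1 c + dist p.2 d) := by fun_prop
    simpa using this.tendsto (c, d)
  · exact (Isometry.of_dist_eq hneg).continuous

theorem spectre_trivial {X : Type*} [AddCommGroup X] (F : Set X) (b : X)
    (h3 : ∀ l : X, ∃ k ∈ F, ∃ k' ∈ F, k ≠ l ∧ k' ≠ l ∧ k ≠ k')
    (hb : ∀ m ∈ F, ∀ l ∈ F, ∀ k ∈ F, b ≠ m + l - k) :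
    spectre (insert b F) = {0} := by
  have key : ∀ l ∈ F, ∀ z : X, z = b - l → z ≠ 0 →
      ∃ k ∈ F, ¬ (k + z ∈ insert b F ∨ k - z ∈ insert b F) := by
    intro l hl z hz h0
    by_contra! hcon
    have h2 : ∀ k ∈ F, k ≠ l → b + b = k + l := by
      intro k hk hkl
      rcases hcon k hk with (h | h) | (h | h)
      · exact absurd (by
          have : k - l = 0 := by rw [hz] at h; rw [← sub_eq_zero] at h; rw [← h]; abel
          exact sub_eq_zero.1 this) hkl
      · exact absurd (by rw [hz]; abel) (hb _ h l hl k hk)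
      · rw [hz] at h
        rw [← sub_eq_zero] at h ⊢
        rw [← neg_eq_zero, ← h]; abel
      · exact absurd (by rw [hz]; abel) (hb k hk l hl _ h)
    obtain ⟨k, hk, k', hk', h1, h1', hne⟩ := h3 l
    exact hne (add_right_cancel ((h2 k hk h1).symm.trans (h2 k' hk' h1')))
  ext z
  refine ⟨fun hz => ?_, fun hz => ?_⟩
  · by_contra h0
    have h0 : z ≠ 0 := h0
    rcases hz b (Set.mem_insert _ _) with (h | h) | (h | h)
    · exact h0 (by simpa using h)
    · obtain ⟨k, hk, hn⟩ := key _ h (-z) (by abel) (by simpa using h0)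
      apply hn
      have := hz k (Set.mem_insert_of_mem _ hk)
      rw [← sub_eq_add_neg, sub_neg_eq_add]
      exact this.symm
    · exact h0 (by simpa using h)
    · obtain ⟨k, hk, hn⟩ := key _ h z (by abel) h0
      exact hn (hz k (Set.mem_insert_of_mem _ hk))
  · rw [Set.mem_singleton_iff.1 hz]; exact spectre_zero_mem _

theorem exists_trivial {X : Type*} [AddCommGroup X] [MetricSpace X]
    (hball : ∀ (x : X) (r : ℝ), 0 < r → (Metric.ball x r).Infinite)
    (A : Set X) (hAne : A.Nonempty) (hAc : IsCompact A) (r : ℝ) (hr : 0 < r) :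
    ∃ B : Set X, B.Nonempty ∧ IsCompact B ∧ hausdorffDist A B ≤ r ∧ spectre B = {0} := by
  obtain ⟨a, ha⟩ := hAne
  obtain ⟨F0, hF0A, hF0f, hF0⟩ := hAc.finite_cover_balls hr
  obtain ⟨T, hT, hTc⟩ := (hball a r hr).exists_subset_card_eq 3
  set F : Set X := F0 ∪ T with hF
  have hFf : F.Finite := hF0f.union T.finite_toSet
  have hbadf : (((fun p : X × X × X => p.1 + p.2.1 - p.2.2)) '' (F ×ˢ F ×ˢ F)).Finite :=
    (hFf.prod (hFf.prod hFf)).image _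
  obtain ⟨b, hbb, hbn⟩ := ((hball a r hr).sdiff hbadf).nonempty
  refine ⟨insert b F, ⟨b, Set.mem_insert _ _⟩, (hFf.insert b).isCompact, ?_, ?_⟩
  · refine hausdorffDist_le_of_mem_dist hr.le ?_ ?_
    · intro x hx
      have := hF0 hx
      simp only [Set.mem_iUnion, Metric.mem_ball] at this
      obtain ⟨y, hy, hxy⟩ := this
      exact ⟨y, Or.inr (Or.inl hy), hxy.le⟩
    · rintro x (rfl | hx | hx)
      · exact ⟨a, ha, (Metric.mem_ball.1 hbb).le⟩
      · exact ⟨x, hF0A hx, by simpa using hr.le⟩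
      · exact ⟨a, ha, (Metric.mem_ball.1 (hT hx)).le⟩
  · apply spectre_trivial
    · intro l
      classical
      have : 1 < (T.erase l).card := by
        have := Finset.pred_card_le_card_erase (s := T) (a := l)
        omega
      obtain ⟨k, hk, k', hk', hne⟩ := Finset.one_lt_card.1 this
      rw [Finset.mem_erase] at hk hk'
      exact ⟨k, Or.inr hk.2, k', Or.inr hk'.2, hk.1, hk'.1, hne⟩
    · intro m hm l hl k hk h
      exact hbn ⟨(m, l, k), ⟨hm, hl, hk⟩, h.symm⟩

theorem spectre_continuousAt_iff {X : Type*} [AddCommGroup X] [MetricSpace X]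
    [CompleteSpace X] [LocallyCompactSpace X]
    (hd : ∀ x y z : X, dist (x + z) (y + z) = dist x y)
    (hball : ∀ (x : X) (r : ℝ), 0 < r → (Metric.ball x r).Infinite)
    (A : Set X) (hAne : A.Nonempty) (hAc : IsCompact A) :
    (∀ ε > 0, ∃ δ > 0, ∀ B : Set X, B.Nonempty → IsCompact B →
        hausdorffDist A B < δ → hausdorffDist (spectre A) (spectre B) < ε) ↔
      spectre A = ({0} : Set X) := by
  have htg := topGroup_of_inv hd
  constructor
  · intro hcont
    by_contra hne
    have : ∃ z ∈ spectre A, z ≠ 0 := by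
      by_contra! h
      exact hne (Set.Subset.antisymm h (by
        rintro _ rfl
        exact spectre_zero_mem A))
    obtain ⟨z, hz, hz0⟩ := this
    obtain ⟨δ, hδ, H⟩ := hcont (dist z 0) (dist_pos.2 hz0)
    obtain ⟨B, hB, hBc, hAB, hSB⟩ := exists_trivial hball A hAne hAc (δ / 2) (half_pos hδ)
    have h1 := H B hB hBc (by linarith)
    rw [hSB] at h1
    have hbd : Bornology.IsBounded (spectre A) := by
      obtain ⟨x, hx⟩ := hAne
      refine (Metric.isBounded_iff_subset_closedBall 0).2 ⟨diam A, fun w hw => ?_⟩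
      rw [mem_closedBall]
      rcases hw x hx with h | h
      · rw [← dist_add_zero' hd x w]; exact dist_le_diam_of_mem hAc.isBounded h hx
      · rw [← dist_sub_zero' hd x w]; exact dist_le_diam_of_mem hAc.isBounded h hx
    obtain ⟨y, hy, hzy⟩ := exists_dist_lt_of_hausdorffDist_lt hz h1
      (hausdorffEDist_ne_top_of_nonempty_of_bounded ⟨z, hz⟩ (Set.singleton_nonempty 0) hbd
        Bornology.isBounded_singleton)
    rw [Set.mem_singleton_iff.1 hy] at hzy
    exact lt_irrefl _ hzy
  · intro hSA ε hε
    by_contra! hcon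
    rw [hSA] at hcon
    have hpos : ∀ n : ℕ, (0 : ℝ) < 1 / ((n : ℝ) + 1) := fun n => by positivity
    choose B hBne hBc hAB hSB using fun n : ℕ => hcon (1 / ((n : ℝ) + 1)) (hpos n)
    have hz : ∀ n, ∃ z ∈ spectre (B n), ε / 2 < dist z 0 := by
      intro n
      by_contra! h
      have : hausdorffDist ({0} : Set X) (spectre (B n)) ≤ ε / 2 := by
        refine hausdorffDist_le_of_mem_dist (by linarith) ?_ ?_
        · rintro _ rfl
          exact ⟨0, spectre_zero_mem _, by rw [dist_self]; linarith⟩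
        · intro x hx
          exact ⟨0, rfl, h x hx⟩
      have := hSB n
      linarith
    choose z hzS hzε using hz
    have hfin : ∀ n, hausdorffEDist A (B n) ≠ ⊤ := fun n =>
      hausdorffEDist_ne_top_of_nonempty_of_bounded hAne (hBne n) hAc.isBounded (hBc n).isBounded
    have hBA : ∀ n, ∀ y ∈ B n, infDist y A ≤ 1 / ((n : ℝ) + 1) := by
      intro n y hy
      obtain ⟨a, ha, h⟩ := exists_dist_lt_of_hausdorffDist_lt' hy (hAB n) (hfin n)
      exact (infDist_le_dist_of_mem ha).trans (dist_comm a y ▸ h.le)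
    have hAB' : ∀ x ∈ A, ∀ n, ∃ y ∈ B n, dist x y < 1 / ((n : ℝ) + 1) := fun x hx n =>
      exists_dist_lt_of_hausdorffDist_lt hx (hAB n) (hfin n)
    have ht0 : Tendsto (fun n : ℕ => 1 / ((n : ℝ) + 1)) atTop (𝓝 0) :=
      tendsto_one_div_add_atTop_nhds_zero_nat
    have hU : (hyperfilter ℕ : Filter ℕ) ≤ atTop := Nat.hyperfilter_le_atTop
    obtain ⟨r, hr, hK⟩ := hAc.exists_isCompact_cthickening
    set K := cthickening r A
    have hev : ∀ᶠ n in (hyperfilter ℕ : Filter ℕ), z n ∈ K - K := by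
      have := (ht0.mono_left hU).eventually (gt_mem_nhds hr)
      filter_upwards [this] with n hn
      have hBK : ∀ y ∈ B n, y ∈ K := by
        intro y hy
        obtain ⟨a, ha, h⟩ := exists_dist_lt_of_hausdorffDist_lt' hy (hAB n) (hfin n)
        exact mem_cthickening_of_dist_le y a r A ha (dist_comm a y ▸ (h.le.trans hn.le))
      obtain ⟨x, hx⟩ := hBne n
      rcases hzS n x hx with h | h
      · exact ⟨_, hBK _ h, x, hBK _ hx, by simp⟩
      · exact ⟨x, hBK _ hx, _, hBK _ h, by simp⟩
    have hKK : IsCompact (K - K) := by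
      rw [sub_eq_add_neg]
      exact hK.add hK.neg
    obtain ⟨w, -, hw⟩ := hKK.ultrafilter_le_nhds ((hyperfilter ℕ).map z)
      (le_principal_iff.2 hev)
    have hw : Tendsto z (hyperfilter ℕ : Filter ℕ) (𝓝 w) := hw
    have hwS : w ∈ spectre A := by
      intro x hx
      choose y hyB hy using hAB' x hx
      have hyx : Tendsto y (hyperfilter ℕ : Filter ℕ) (𝓝 x) := by
        refine tendsto_iff_dist_tendsto_zero.2 ?_
        refine squeeze_zero (fun _ => dist_nonneg) (fun n => ?_) (ht0.mono_left hU)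
        rw [dist_comm]; exact (hy n).le
      have hlim : ∀ (u : ℕ → X) (v : X), Tendsto u (hyperfilter ℕ : Filter ℕ) (𝓝 v) →
          (∀ᶠ n in (hyperfilter ℕ : Filter ℕ), u n ∈ B n) → v ∈ A := by
        intro u v huv hu
        rw [hAc.isClosed.mem_iff_infDist_zero hAne]
        refine le_antisymm ?_ infDist_nonneg
        refine le_of_tendsto_of_tendsto (((continuous_infDist_pt A).tendsto v).comp huv)
          (ht0.mono_left hU) ?_
        filter_upwards [hu] with n hn using hBA n _ hn
      have hor : ∀ᶠ n in (hyperfilter ℕ : Filter ℕ), y n + z n ∈ B n ∨ y n - z n ∈ B n :=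
        Eventually.of_forall fun n => hzS n _ (hyB n)
      rcases Ultrafilter.eventually_or.1 hor with h | h
      · exact Or.inl (hlim _ _ (hyx.add hw) h)
      · exact Or.inr (hlim _ _ (hyx.sub hw) h)
    rw [hSA] at hwS
    rw [Set.mem_singleton_iff.1 hwS] at hw
    have h1 : Tendsto (fun n => dist (z n) 0) (hyperfilter ℕ : Filter ℕ) (𝓝 0) :=
      tendsto_iff_dist_tendsto_zero.1 hw
    have h2 := ge_of_tendsto h1 (Eventually.of_forall fun n => (hzε n).le)
    linarith
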